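/- arXiv:2405.07186 — 2 statements merged into one kernel-verified Lean document; each statement's English description precedes it below -/
import Mathlib

section
/- Identification of the covariate-pooled ATE (the paper's identification claim under assumptions A1–A3): q_a(W) = Q_a(W) P-almost surely for each a ∈ {0,1}, and consequently E_P[Q₁(W) − Q₀(W)] = E_P[q₁(W) − q₀(W)]; that is, the causal parameter Ψ^F = E_W[E(Y₁ − Y₀ | S=1, W)] equals the statistical estimand Ψ(P) = E_W[E(Y | S=1, W, A=1) − E(Y | S=1, W, A=0)]. -/
open MeasureTheory ProbabilityTheory

/-- identification of the covariate-pooled ATE under randomization (A1),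
positivity of treatment in the trial (A2), and positivity of trial enrollment (A3). -/
theorem covariate_pooled_ate_identification
    {Ω : Type*} [MeasurableSpace Ω] {𝓦 : Type*} [MeasurableSpace 𝓦]
    (P : Measure Ω) [IsProbabilityMeasure P]
    (W : Ω → 𝓦) (A : Ω → ℝ) (S : Ω → ℝ) (Y Y₀ Y₁ : Ω → ℝ)
    (hW : Measurable W) (hA : Measurable A) (hS : Measurable S) (hY : Measurable Y)
    (hA01 : ∀ ω, A ω = 0 ∨ A ω = 1) (hS01 : ∀ ω, S ω = 0 ∨ S ω = 1)
    (hY₀ : Integrable Y₀ P) (hY₁ : Integrable Y₁ P)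
    (hconsistency : ∀ᵐ ω ∂P, Y ω = A ω * Y₁ ω + (1 - A ω) * Y₀ ω)
    (hPS : 0 < (P {ω | S ω = 1}).toReal)
    (μ' : Measure Ω) (hμ' : μ' = P[|{ω | S ω = 1}])
    (gbar : ℝ → 𝓦 → ℝ)
    (hgbar : ∀ a ∈ ({0, 1} : Set ℝ), Measurable (gbar a))
    (hgbar01 : ∀ a ∈ ({0, 1} : Set ℝ), ∀ w, gbar a w ∈ Set.Icc (0 : ℝ) 1)
    (hgbarCE : ∀ a ∈ ({0, 1} : Set ℝ),
      (fun ω => gbar a (W ω)) =ᵐ[μ']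
        μ'[(fun ω => if A ω = a then (1 : ℝ) else 0) |
          MeasurableSpace.comap W inferInstance])
    (Qa : ℝ → 𝓦 → ℝ)
    (hQa : ∀ a ∈ ({0, 1} : Set ℝ), Measurable (Qa a))
    (hQaCE : ∀ a ∈ ({0, 1} : Set ℝ),
      (fun ω => Qa a (W ω)) =ᵐ[μ']
        μ'[(fun ω => a * Y₁ ω + (1 - a) * Y₀ ω) |
          MeasurableSpace.comap W inferInstance])
    (q : ℝ → 𝓦 → ℝ)
    (hq : ∀ a ∈ ({0, 1} : Set ℝ), Measurable (q a))
    (hqDef : ∀ a ∈ ({0, 1} : Set ℝ), ∀ f : 𝓦 → ℝ, Measurable f →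
      (∃ C : ℝ, ∀ w, |f w| ≤ C) →
      ∫ ω, Y ω * (if A ω = a then (1 : ℝ) else 0) * f (W ω) ∂μ'
        = ∫ ω, q a (W ω) * gbar a (W ω) * f (W ω) ∂μ')
    (hA1 : ∀ a ∈ ({0, 1} : Set ℝ), ∀ f : 𝓦 → ℝ, Measurable f →
      (∃ C : ℝ, ∀ w, |f w| ≤ C) →
      ∫ ω, (a * Y₁ ω + (1 - a) * Y₀ ω) * (if A ω = a then (1 : ℝ) else 0)
          * f (W ω) ∂μ'
        = ∫ ω, Qa a (W ω) * gbar a (W ω) * f (W ω) ∂μ')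
    (hA2 : ∀ a ∈ ({0, 1} : Set ℝ), ∀ᵐ ω ∂μ', 0 < gbar a (W ω))
    (Pib : 𝓦 → ℝ) (hPib : Measurable Pib) (hPib01 : ∀ w, Pib w ∈ Set.Icc (0 : ℝ) 1)
    (hPibCE : (fun ω => Pib (W ω)) =ᵐ[P]
      P[S | MeasurableSpace.comap W inferInstance])
    (hA3 : ∀ᵐ ω ∂P, 0 < Pib (W ω))
    (hQaInt : ∀ a ∈ ({0, 1} : Set ℝ), Integrable (fun ω => Qa a (W ω)) P)
    (hqInt : ∀ a ∈ ({0, 1} : Set ℝ), Integrable (fun ω => q a (W ω)) P) :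
    (∀ a ∈ ({0, 1} : Set ℝ),
      (fun ω => q a (W ω)) =ᵐ[P] fun ω => Qa a (W ω)) ∧
    ∫ ω, (Qa 1 (W ω) - Qa 0 (W ω)) ∂P = ∫ ω, (q 1 (W ω) - q 0 (W ω)) ∂P := by
  have hs : MeasurableSet {ω | S ω = 1} := hS (measurableSet_singleton 1)
  have hP0 : P {ω | S ω = 1} ≠ 0 := by
    intro h; rw [h] at hPS; simp at hPS
  have hac : μ' ≪ P := by
    rw [hμ']; exact ProbabilityTheory.cond_absolutelyContinuous
  have hint : ∀ g : Ω → ℝ, Integrable g P → Integrable g μ' := by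
    intro g hg
    rw [hμ', ProbabilityTheory.cond]
    exact hg.restrict.smul_measure (ENNReal.inv_ne_top.2 hP0)
  have key : ∀ a ∈ ({0, 1} : Set ℝ),
      (fun ω => q a (W ω)) =ᵐ[P] fun ω => Qa a (W ω) := by
    intro a ha
    have hYa : ∀ᵐ ω ∂μ', ∀ c : ℝ, Y ω * (if A ω = a then (1 : ℝ) else 0) * c
        = (a * Y₁ ω + (1 - a) * Y₀ ω) * (if A ω = a then (1 : ℝ) else 0) * c := by
      filter_upwards [hac.ae_le hconsistency] with ω hω c
      by_cases h : A ω = a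
      · rw [hω, h]
      · simp [h]
    have hgm : Measurable (fun ω => gbar a (W ω)) := (hgbar a ha).comp hW
    have hgb : ∀ ω, ‖gbar a (W ω)‖ ≤ 1 := by
      intro ω
      have := hgbar01 a ha (W ω)
      rw [Real.norm_eq_abs, abs_of_nonneg this.1]; exact this.2
    let f : 𝓦 → ℝ := fun w => if Qa a w ≤ q a w then 1 else -1
    have hf : Measurable f :=
      Measurable.ite (measurableSet_le (hQa a ha) (hq a ha)) measurable_const measurable_const
    have hfb : ∀ w, |f w| ≤ 1 := by
      intro w; by_cases h : Qa a w ≤ q a w <;> simp [f, h]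
    have hfm : Measurable (fun ω => f (W ω)) := hf.comp hW
    have hI : ∀ h : Ω → ℝ, Integrable h P →
        Integrable (fun ω => h ω * gbar a (W ω) * f (W ω)) μ' := by
      intro h hh
      exact ((hint h hh).mul_bdd (c := 1) hgm.aestronglyMeasurable
        (Filter.Eventually.of_forall hgb)).mul_bdd (c := 1) hfm.aestronglyMeasurable
        (Filter.Eventually.of_forall fun ω => hfb (W ω))
    have h1 := hqDef a ha f hf ⟨1, hfb⟩
    have h2 := hA1 a ha f hf ⟨1, hfb⟩
    have h3 := integral_congr_ae (hYa.mono fun ω h => h (f (W ω)))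
    have h4 : ∫ ω, (q a (W ω) * gbar a (W ω) * f (W ω)
        - Qa a (W ω) * gbar a (W ω) * f (W ω)) ∂μ' = 0 := by
      rw [integral_sub (hI _ (hqInt a ha)) (hI _ (hQaInt a ha))]
      linarith
    have hnn : ∀ ω, q a (W ω) * gbar a (W ω) * f (W ω)
        - Qa a (W ω) * gbar a (W ω) * f (W ω) = |q a (W ω) - Qa a (W ω)| * gbar a (W ω) := by
      intro ω
      by_cases h : Qa a (W ω) ≤ q a (W ω)
      · simp only [f, h, if_true]; rw [abs_of_nonneg (by linarith)]; ring
      · simp only [f, h, if_false]; rw [abs_of_neg (by linarith)]; ring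
    have h5 := (integral_eq_zero_iff_of_nonneg (μ := μ') (fun ω => by
      simp only [Pi.zero_apply, Pi.sub_apply]
      rw [hnn ω]
      exact mul_nonneg (abs_nonneg _) (hgbar01 a ha (W ω)).1)
      ((hI _ (hqInt a ha)).sub (hI _ (hQaInt a ha)))).1 h4
    have h6 : ∀ᵐ ω ∂μ', q a (W ω) = Qa a (W ω) := by
      filter_upwards [h5, hA2 a ha] with ω hω hg
      simp only [Pi.zero_apply, Pi.sub_apply] at hω
      rw [hnn ω] at hω
      rcases mul_eq_zero.1 hω with h | h
      · linarith [abs_eq_zero.1 h]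
      · linarith
    let D : Set 𝓦 := {w | q a w ≠ Qa a w}
    have hD : MeasurableSet D := (measurableSet_eq_fun (hq a ha) (hQa a ha)).compl
    have hWD : MeasurableSet (W ⁻¹' D) := hW hD
    have h7 : ∀ᵐ ω ∂P, S ω = 1 → q a (W ω) = Qa a (W ω) := by
      rw [hμ', ProbabilityTheory.cond, Measure.ae_ennreal_smul_measure_iff
        (ENNReal.inv_ne_zero.2 (measure_ne_top _ _))] at h6
      exact (ae_restrict_iff' hs).1 h6
    have hSint : Integrable S P := by
      refine Integrable.of_bound hS.aestronglyMeasurable 1 (Filter.Eventually.of_forall fun ω => ?_)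
      rcases hS01 ω with h | h <;> simp [h]
    have hPint : Integrable (fun ω => Pib (W ω)) P :=
      integrable_condExp.congr hPibCE.symm
    have h8 : ∫ ω in W ⁻¹' D, Pib (W ω) ∂P = 0 := by
      have e1 : ∫ ω in W ⁻¹' D, Pib (W ω) ∂P = ∫ ω in W ⁻¹' D, S ω ∂P := by
        rw [← setIntegral_condExp hW.comap_le hSint ⟨D, hD, rfl⟩]
        exact setIntegral_congr_ae hWD (hPibCE.mono fun ω h _ => h)
      rw [e1]
      refine setIntegral_eq_zero_of_ae_eq_zero ?_
      filter_upwards [h7] with ω hω hωD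
      rcases hS01 ω with h | h
      · exact h
      · exact absurd (hω h) hωD
    have h9 := (setIntegral_eq_zero_iff_of_nonneg_ae
      (Filter.Eventually.of_forall fun ω => (hPib01 (W ω)).1) hPint.integrableOn).1 h8
    have h10 := (ae_restrict_iff' hWD).1 h9
    filter_upwards [h10, hA3] with ω hω hp
    by_contra hne
    have := hω hne
    simp only [Pi.zero_apply] at this
    linarith
  refine ⟨key, integral_congr_ae ?_⟩
  filter_upwards [key 0 (by simp), key 1 (by simp)] with ω h0 h1
  rw [h0, h1]
end

section
/- Inverse-probability-of-censoring weighting identity: for every bounded measurable h : {0,1}×𝒲×{0,1}×ℝ → ℝ, E[(Δ/gΔ(S,W,A))·h(S,W,A,Y)] = E[h(S,W,A,Y)]. In particular, the population risk of any inverse-probability-of-censoring-weighted loss equals the corresponding full-data risk. -/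
open MeasureTheory

/-- inverse-probability-of-censoring weighting identity under coarsening
at random: the IPCW risk equals the full-data risk for any bounded loss. -/
theorem ipcw_identity
    {Ω : Type*} [MeasurableSpace Ω] {𝓦 : Type*} [MeasurableSpace 𝓦]
    (P : Measure Ω) [IsProbabilityMeasure P]
    (W : Ω → 𝓦) (A : Ω → ℝ) (S : Ω → ℝ) (Δ : Ω → ℝ) (Y : Ω → ℝ)
    (hW : Measurable W) (hA : Measurable A) (hS : Measurable S)
    (hΔ : Measurable Δ) (hY : Measurable Y)
    (hA01 : ∀ ω, A ω = 0 ∨ A ω = 1) (hS01 : ∀ ω, S ω = 0 ∨ S ω = 1)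
    (hΔ01 : ∀ ω, Δ ω = 0 ∨ Δ ω = 1)
    (gΔ : ℝ → 𝓦 → ℝ → ℝ)
    (hgΔ : Measurable fun p : ℝ × 𝓦 × ℝ => gΔ p.1 p.2.1 p.2.2)
    (hgΔ01 : ∀ s w a, gΔ s w a ∈ Set.Icc (0 : ℝ) 1)
    (hgΔCE : (fun ω => gΔ (S ω) (W ω) (A ω)) =ᵐ[P]
      P[Δ | MeasurableSpace.comap (fun ω => (S ω, W ω, A ω)) inferInstance])
    (δ : ℝ) (hδ : 0 < δ)
    (hgΔδ : ∀ᵐ ω ∂P, δ ≤ gΔ (S ω) (W ω) (A ω))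
    (hCAR : ∀ k : ℝ → ℝ, Measurable k → (∃ C : ℝ, ∀ y, |k y| ≤ C) →
      P[(fun ω => Δ ω * k (Y ω)) |
          MeasurableSpace.comap (fun ω => (S ω, W ω, A ω)) inferInstance]
        =ᵐ[P] fun ω => gΔ (S ω) (W ω) (A ω)
          * (P[(fun ω' => k (Y ω')) |
              MeasurableSpace.comap (fun ω' => (S ω', W ω', A ω')) inferInstance]) ω) :
    ∀ h : ℝ → 𝓦 → ℝ → ℝ → ℝ,
      (Measurable fun p : ℝ × 𝓦 × ℝ × ℝ => h p.1 p.2.1 p.2.2.1 p.2.2.2) →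
      (∃ C : ℝ, ∀ s w a y, |h s w a y| ≤ C) →
      ∫ ω, (Δ ω / gΔ (S ω) (W ω) (A ω)) * h (S ω) (W ω) (A ω) (Y ω) ∂P
        = ∫ ω, h (S ω) (W ω) (A ω) (Y ω) ∂P := by
  intro h hh _
  have hX : Measurable fun ω => (S ω, W ω, A ω) := hS.prodMk (hW.prodMk hA)
  set X : Ω → ℝ × 𝓦 × ℝ := fun ω => (S ω, W ω, A ω) with hXdef
  have hm : MeasurableSpace.comap X inferInstance ≤ (inferInstance : MeasurableSpace Ω) :=
    hX.comap_le
  set G : Ω → ℝ := fun ω => gΔ (S ω) (W ω) (A ω) with hGdef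
  have hGm : Measurable G := hgΔ.comp hX
  have hG0 : ∀ ω, 0 ≤ G ω := fun ω => (hgΔ01 _ _ _).1
  have hΔ0 : ∀ ω, 0 ≤ Δ ω := fun ω => by rcases hΔ01 ω with h | h <;> simp [h]
  have hΔ1 : ∀ ω, Δ ω ≤ 1 := fun ω => by rcases hΔ01 ω with h | h <;> simp [h]
  have hf0 : ∀ ω, 0 ≤ Δ ω / G ω := fun ω => div_nonneg (hΔ0 ω) (hG0 ω)
  have hfm : Measurable fun ω => Δ ω / G ω := hΔ.div hGm
  have hfi : Integrable (fun ω => Δ ω / G ω) P := by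
    refine Integrable.of_bound hfm.aestronglyMeasurable (1 / δ) ?_
    filter_upwards [hgΔδ] with ω hω
    rw [Real.norm_of_nonneg (hf0 ω)]
    exact div_le_div₀ zero_le_one (hΔ1 ω) hδ hω
  have hZ : Measurable fun ω => (X ω, Y ω) := hX.prodMk hY
  -- the identity on measurable rectangles
  have key : ∀ s : Set (ℝ × 𝓦 × ℝ), MeasurableSet s → ∀ t : Set ℝ, MeasurableSet t →
      ∫ ω in X ⁻¹' s ∩ Y ⁻¹' t, Δ ω / G ω ∂P = ∫ ω in X ⁻¹' s ∩ Y ⁻¹' t, (1 : ℝ) ∂P := by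
    intro s hs t ht
    set k : ℝ → ℝ := t.indicator 1 with hk
    have hkm : Measurable k := measurable_one.indicator ht
    have hkb : ∀ y, |k y| ≤ 1 := fun y => by
      by_cases hy : y ∈ t <;> simp [hk, hy]
    have hcar := hCAR k hkm ⟨1, hkb⟩
    have hum : StronglyMeasurable[MeasurableSpace.comap X inferInstance]
        (fun ω => s.indicator (1 : ℝ × 𝓦 × ℝ → ℝ) (X ω)) :=
      ((measurable_one.indicator hs).comp (comap_measurable X)).stronglyMeasurable
    have hGm' : Measurable[MeasurableSpace.comap X inferInstance] G :=
      hgΔ.comp (comap_measurable X)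
    have hvm : StronglyMeasurable[MeasurableSpace.comap X inferInstance]
        (fun ω => s.indicator (1 : ℝ × 𝓦 × ℝ → ℝ) (X ω) / G ω) :=
      (hum.measurable.div hGm').stronglyMeasurable
    have hub : ∀ ω, |s.indicator (1 : ℝ × 𝓦 × ℝ → ℝ) (X ω)| ≤ 1 := fun ω => by
      by_cases hy : X ω ∈ s <;> simp [hy]
    have hki : Integrable (fun ω => k (Y ω)) P :=
      Integrable.of_bound (hkm.comp hY).aestronglyMeasurable 1
        (Filter.Eventually.of_forall fun ω => hkb _)
    have hdi : Integrable (fun ω => Δ ω * k (Y ω)) P := by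
      refine Integrable.of_bound (hΔ.mul (hkm.comp hY)).aestronglyMeasurable 1
        (Filter.Eventually.of_forall fun ω => ?_)
      rw [norm_mul, Real.norm_of_nonneg (hΔ0 ω)]
      exact mul_le_one₀ (hΔ1 ω) (norm_nonneg _) (hkb _)
    have hi1 : Integrable ((fun ω => s.indicator (1 : ℝ × 𝓦 × ℝ → ℝ) (X ω)) * fun ω => k (Y ω)) P :=
      hki.bdd_mul (c := 1) (hum.mono hm).aestronglyMeasurable (Filter.Eventually.of_forall hub)
    have hi2 : Integrable ((fun ω => s.indicator (1 : ℝ × 𝓦 × ℝ → ℝ) (X ω) / G ω) *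
        fun ω => Δ ω * k (Y ω)) P := by
      refine hdi.bdd_mul (c := 1 / δ) (hvm.mono hm).aestronglyMeasurable ?_
      filter_upwards [hgΔδ] with ω hω
      rw [norm_div, Real.norm_of_nonneg (hG0 ω)]
      exact div_le_div₀ zero_le_one (hub ω) hδ hω
    have e1 := condExp_mul_of_stronglyMeasurable_left hum hi1 hki
    have e2 := condExp_mul_of_stronglyMeasurable_left hvm hi2 hdi
    have e3 : P[(fun ω => s.indicator (1 : ℝ × 𝓦 × ℝ → ℝ) (X ω) / G ω) *
        fun ω => Δ ω * k (Y ω) | MeasurableSpace.comap X inferInstance] =ᵐ[P]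
        P[(fun ω => s.indicator (1 : ℝ × 𝓦 × ℝ → ℝ) (X ω)) * fun ω => k (Y ω) |
          MeasurableSpace.comap X inferInstance] := by
      filter_upwards [e1, e2, hcar, hgΔδ] with ω h1 h2 h3 h4
      have hne : G ω ≠ 0 := (hδ.trans_le h4).ne'
      rw [h1, h2, Pi.mul_apply, Pi.mul_apply, h3]
      change _ / G ω * (G ω * _) = _
      field_simp
    have e4 := integral_congr_ae e3
    rw [integral_condExp hm, integral_condExp hm] at e4
    rw [← integral_indicator ((hX hs).inter (hY ht)), ← integral_indicator ((hX hs).inter (hY ht))]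
    convert e4 using 2
    · ext ω
      by_cases h1 : X ω ∈ s <;> by_cases h2 : Y ω ∈ t <;> simp [h1, h2, hk] <;> ring
    · ext ω
      by_cases h1 : X ω ∈ s <;> by_cases h2 : Y ω ∈ t <;> simp [h1, h2, hk]
  set Q : Measure Ω := P.withDensity fun ω => ENNReal.ofReal (Δ ω / G ω) with hQ
  have : IsFiniteMeasure Q := isFiniteMeasure_withDensity_ofReal hfi.2
  have hmap : Q.map (fun ω => (X ω, Y ω)) = P.map (fun ω => (X ω, Y ω)) := by
    refine Measure.ext_prod fun {s t} hs ht => ?_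
    have hst : MeasurableSet (X ⁻¹' s ∩ Y ⁻¹' t) := (hX hs).inter (hY ht)
    rw [Measure.map_apply hZ (hs.prod ht), Measure.map_apply hZ (hs.prod ht)]
    change Q (X ⁻¹' s ∩ Y ⁻¹' t) = P (X ⁻¹' s ∩ Y ⁻¹' t)
    rw [hQ, withDensity_apply _ hst, ← ofReal_integral_eq_lintegral_ofReal hfi.integrableOn
      (Filter.Eventually.of_forall hf0), key s hs t ht]
    simp
  have hH : Measurable fun p : (ℝ × 𝓦 × ℝ) × ℝ => h p.1.1 p.1.2.1 p.1.2.2 p.2 :=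
    hh.comp (f := fun p : (ℝ × 𝓦 × ℝ) × ℝ => (p.1.1, p.1.2.1, p.1.2.2, p.2)) (by fun_prop)
  have a1 := integral_map (μ := Q) hZ.aemeasurable hH.aestronglyMeasurable
  have a2 := integral_map (μ := P) hZ.aemeasurable hH.aestronglyMeasurable
  rw [hmap, a2, hQ, integral_withDensity_eq_integral_toReal_smul hfm.ennreal_ofReal
    (Filter.Eventually.of_forall fun _ => ENNReal.ofReal_lt_top)] at a1
  rw [show (∫ ω, h (S ω) (W ω) (A ω) (Y ω) ∂P) = _ from a1]
  refine integral_congr_ae (Filter.Eventually.of_forall fun ω => ?_)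
  simp only [smul_eq_mul, ENNReal.toReal_ofReal (hf0 ω)]
  rfl
end
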